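/- Lyapunov Lemma: A real n×n matrix A is Hurwitz if and only if for every symmetric positive definite n×n real matrix P there exists a symmetric positive definite n×n real matrix Q satisfying the Lyapunov equation AᵀQ + QA = −P; moreover, such Q is unique. -/

import Mathlib

open Matrix

/-- A real square matrix is Hurwitz if all of its complex eigenvalues have strictly
negative real part. -/
def IsHurwitz {n : ℕ} (A : Matrix (Fin n) (Fin n) ℝ) : Prop :=
  ∀ μ ∈ spectrum ℂ (A.map ((↑) : ℝ → ℂ)), μ.re < 0

open Filter Topology

/-- Spectrum of a complex matrix via eigenvectors. -/
lemma mem_spectrum_iff_eigvec {n : ℕ} (M : Matrix (Fin n) (Fin n) ℂ) (μ : ℂ) :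
    μ ∈ spectrum ℂ M ↔ ∃ v : Fin n → ℂ, v ≠ 0 ∧ M *ᵥ v = μ • v := by
  rw [spectrum.mem_iff, Matrix.isUnit_iff_isUnit_det, isUnit_iff_ne_zero, not_not,
    ← Matrix.exists_mulVec_eq_zero_iff]
  refine exists_congr fun v => and_congr_right fun _ => ?_
  rw [Matrix.sub_mulVec, Algebra.algebraMap_eq_smul_one, Matrix.smul_mulVec, Matrix.one_mulVec,
    sub_eq_zero, eq_comm]

section gelfand
attribute [local instance] Matrix.linftyOpNormedRing Matrix.linftyOpNormedAlgebra

/-- Powers of a complex matrix with spectrum in the open unit disc tend to zero. -/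
lemma tendsto_pow_zero_of_spectrum {n : ℕ} (M : Matrix (Fin n) (Fin n) ℂ)
    (h : ∀ z ∈ spectrum ℂ M, ‖z‖ < 1) : Tendsto (fun k : ℕ => M ^ k) atTop (𝓝 0) := by
  rcases Nat.eq_zero_or_pos n with rfl | hn
  · have : (fun k : ℕ => M ^ k) = fun _ => 0 := by
      funext k; exact Subsingleton.elim _ _
    rw [this]; exact tendsto_const_nhds
  have : Nonempty (Fin n) := ⟨⟨0, hn⟩⟩
  have : CompleteSpace (Matrix (Fin n) (Fin n) ℂ) := FiniteDimensional.complete ℂ _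
  have h1 : spectralRadius ℂ M < ((1 : NNReal) : ENNReal) :=
    spectrum.spectralRadius_lt_of_forall_lt M (fun z hz => by
      rw [← NNReal.coe_lt_coe]; simpa using h z hz)
  obtain ⟨r, hr1, hr2⟩ := ENNReal.lt_iff_exists_nnreal_btwn.1 h1
  have hr2' : r < 1 := by exact_mod_cast hr2
  have h2 := (spectrum.pow_nnnorm_pow_one_div_tendsto_nhds_spectralRadius M).eventually
    (gt_mem_nhds hr1)
  refine tendsto_zero_iff_norm_tendsto_zero.2 ?_
  refine squeeze_zero' (Eventually.of_forall fun _ => norm_nonneg _) ?_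
    (tendsto_pow_atTop_nhds_zero_of_lt_one r.coe_nonneg (by exact_mod_cast hr2'))
  filter_upwards [h2, eventually_gt_atTop 0] with k hk hk0
  have hk' : (k : ℝ) ≠ 0 := by positivity
  have h3 := ENNReal.rpow_le_rpow hk.le (Nat.cast_nonneg k : (0 : ℝ) ≤ k)
  rw [← ENNReal.rpow_mul, one_div, inv_mul_cancel₀ hk', ENNReal.rpow_one,
    ENNReal.rpow_natCast] at h3
  have h4 : ‖M ^ k‖₊ ≤ r ^ k := by exact_mod_cast h3
  exact_mod_cast h4
end gelfand

/-- The Cayley transform of a Hurwitz matrix. -/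
lemma exists_cayley {n : ℕ} {A : Matrix (Fin n) (Fin n) ℝ} (hA : IsHurwitz A) :
    ∃ B G : Matrix (Fin n) (Fin n) ℝ, B * (1 - A) = 1 + A ∧ (1 - A) * G = 1 ∧ G * (1 - A) = 1 ∧
      Tendsto (fun k : ℕ => B ^ k) atTop (𝓝 0) := by
  have hdet : IsUnit (1 - A).det := by
    rw [isUnit_iff_ne_zero]
    intro h0
    obtain ⟨x, hx, hx0⟩ := Matrix.exists_mulVec_eq_zero_iff.2 h0
    rw [Matrix.sub_mulVec, Matrix.one_mulVec, sub_eq_zero] at hx0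
    have := hA 1 ((mem_spectrum_iff_eigvec _ _).2 ⟨fun i => (x i : ℂ), ?_, ?_⟩)
    · norm_num at this
    · intro h
      apply hx
      funext i
      simpa using congrFun h i
    · funext i
      have := congrFun hx0 i
      simp only [Matrix.mulVec, dotProduct] at this
      simp only [Matrix.mulVec, dotProduct, Matrix.map_apply, Pi.smul_apply, one_smul]
      rw [this]
      push_cast
      rfl
  set G := (1 - A)⁻¹ with hG
  have hG1 : (1 - A) * G = 1 := Matrix.mul_nonsing_inv _ hdet
  have hG2 : G * (1 - A) = 1 := Matrix.nonsing_inv_mul _ hdet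
  refine ⟨(1 + A) * G, G, by rw [Matrix.mul_assoc, hG2, Matrix.mul_one], hG1, hG2, ?_⟩
  set φ := (Complex.ofRealHom).mapMatrix (m := Fin n) with hφ
  have hc : Tendsto (fun k : ℕ => (φ ((1 + A) * G)) ^ k) atTop (𝓝 0) := by
    apply tendsto_pow_zero_of_spectrum
    intro z hz
    obtain ⟨v, hv, hvz⟩ := (mem_spectrum_iff_eigvec _ _).1 hz
    obtain ⟨w, hw⟩ : ∃ w, w = φ G *ᵥ v := ⟨_, rfl⟩
    have e1 : w - φ A *ᵥ w = v := by
      have : φ (1 - A) *ᵥ w = v := by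
        rw [hw, Matrix.mulVec_mulVec, ← map_mul, hG1, map_one, Matrix.one_mulVec]
      rwa [map_sub, map_one, Matrix.sub_mulVec, Matrix.one_mulVec] at this
    have e2 : w + φ A *ᵥ w = z • v := by
      have : φ (1 + A) *ᵥ w = z • v := by
        rw [hw, Matrix.mulVec_mulVec, ← map_mul, hvz]
      rwa [map_add, map_one, Matrix.add_mulVec, Matrix.one_mulVec] at this
    have hw0 : w ≠ 0 := by
      rintro rfl
      apply hv
      rw [← e1]; simp
    have e3 : (1 + z) • (φ A *ᵥ w) = (z - 1) • w := by
      rw [← e1] at e2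
      funext i
      have := congrFun e2 i
      simp only [Pi.add_apply, Pi.sub_apply, Pi.smul_apply, smul_eq_mul] at this ⊢
      linear_combination this
    have hz1 : 1 + z ≠ 0 := by
      intro h
      have hz' : z = -1 := by linear_combination h
      rw [h, zero_smul] at e3
      have := smul_eq_zero.1 e3.symm
      rcases this with h' | h'
      · rw [hz'] at h'; norm_num at h'
      · exact hw0 h'
    have e4 : φ A *ᵥ w = ((z - 1) / (1 + z)) • w := by
      rw [div_eq_inv_mul, mul_smul, ← e3, smul_smul, inv_mul_cancel₀ hz1, one_smul]
    have := hA _ ((mem_spectrum_iff_eigvec _ _).2 ⟨w, hw0, e4⟩)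
    have hpos : 0 < Complex.normSq (1 + z) := Complex.normSq_pos.2 hz1
    rw [Complex.div_re, ← add_div, div_neg_iff] at this
    have h5 : (z - 1).re * (1 + z).re + (z - 1).im * (1 + z).im < 0 := by
      rcases this with h | h
      · linarith [h.2]
      · exact h.1
    simp only [Complex.sub_re, Complex.add_re, Complex.one_re, Complex.sub_im, Complex.add_im,
      Complex.one_im] at h5
    have h6 : ‖z‖ ^ 2 < 1 := by
      rw [← Complex.normSq_eq_norm_sq, Complex.normSq_apply]
      nlinarith
    nlinarith [norm_nonneg z]
  have hcont : Continuous fun M : Matrix (Fin n) (Fin n) ℂ => M.map Complex.re :=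
    continuous_id.matrix_map Complex.continuous_re
  have := (hcont.tendsto 0).comp hc
  have h0 : (0 : Matrix (Fin n) (Fin n) ℂ).map Complex.re = 0 := by ext; simp
  rw [h0] at this
  refine this.congr fun k => ?_
  simp only [Function.comp]
  rw [← map_pow]
  ext i j
  simp [hφ]

lemma cayley_identity {n : ℕ} {A B : Matrix (Fin n) (Fin n) ℝ} (hB : B * (1 - A) = 1 + A)
    (X : Matrix (Fin n) (Fin n) ℝ) :
    (1 - A)ᵀ * (X - Bᵀ * X * B) * (1 - A) = -(2 : ℝ) • (Aᵀ * X + X * A) := by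
  have h2 : (1 - A)ᵀ * Bᵀ = (1 + A)ᵀ := by rw [← Matrix.transpose_mul, hB]
  have : (1 - A)ᵀ * (X - Bᵀ * X * B) * (1 - A)
      = (1 - A)ᵀ * X * (1 - A) - ((1 - A)ᵀ * Bᵀ) * X * (B * (1 - A)) := by noncomm_ring
  rw [this, h2, hB, Matrix.transpose_sub, Matrix.transpose_add, Matrix.transpose_one, neg_smul,
    two_smul]
  noncomm_ring

lemma lyap_inj {n : ℕ} {A : Matrix (Fin n) (Fin n) ℝ} (hA : IsHurwitz A)
    (X : Matrix (Fin n) (Fin n) ℝ) (hX : Aᵀ * X + X * A = 0) : X = 0 := by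
  obtain ⟨B, G, hB, hG1, hG2, hlim⟩ := exists_cayley hA
  have h1 := cayley_identity hB X
  rw [hX, smul_zero] at h1
  have hG3 : Gᵀ * (1 - A)ᵀ = 1 := by rw [← Matrix.transpose_mul, hG1, Matrix.transpose_one]
  have h2 : X - Bᵀ * X * B = 0 := by
    calc X - Bᵀ * X * B = (Gᵀ * (1 - A)ᵀ) * (X - Bᵀ * X * B) * ((1 - A) * G) := by
          rw [hG3, hG1, Matrix.one_mul, Matrix.mul_one]
      _ = Gᵀ * ((1 - A)ᵀ * (X - Bᵀ * X * B) * (1 - A)) * G := by simp only [Matrix.mul_assoc]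
      _ = 0 := by rw [h1]; simp
  have h3 : ∀ k : ℕ, (B ^ k)ᵀ * X * B ^ k = X := by
    intro k
    induction k with
    | zero => simp
    | succ k ih =>
      rw [pow_succ, Matrix.transpose_mul]
      calc Bᵀ * (B ^ k)ᵀ * X * (B ^ k * B) = Bᵀ * ((B ^ k)ᵀ * X * B ^ k) * B := by
            simp only [Matrix.mul_assoc]
        _ = X := by rw [ih]; exact (sub_eq_zero.1 h2).symm
  have hcont : Continuous fun M : Matrix (Fin n) (Fin n) ℝ => Mᵀ * X * M := by fun_prop
  have h4 := (hcont.tendsto 0).comp hlim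
  simp only [Matrix.mul_zero] at h4
  have h5 : ((fun M : Matrix (Fin n) (Fin n) ℝ => Mᵀ * X * M) ∘ fun k : ℕ => B ^ k)
      = fun _ => X := by
    funext k; exact h3 k
  rw [h5] at h4
  exact tendsto_nhds_unique tendsto_const_nhds h4

lemma quad_transpose {n : ℕ} (M X : Matrix (Fin n) (Fin n) ℝ) (x : Fin n → ℝ) :
    x ⬝ᵥ ((Mᵀ * X * M) *ᵥ x) = (M *ᵥ x) ⬝ᵥ (X *ᵥ (M *ᵥ x)) := by
  rw [← Matrix.mulVec_mulVec, ← Matrix.mulVec_mulVec, Matrix.dotProduct_mulVec,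
    Matrix.vecMul_transpose]

lemma lyap_pos {n : ℕ} {A : Matrix (Fin n) (Fin n) ℝ} (hA : IsHurwitz A)
    {P Q : Matrix (Fin n) (Fin n) ℝ} (hP : P.PosDef) (hQ : Aᵀ * Q + Q * A = -P)
    (x : Fin n → ℝ) (hx : x ≠ 0) : 0 < x ⬝ᵥ (Q *ᵥ x) := by
  obtain ⟨B, G, hB, hG1, hG2, hlim⟩ := exists_cayley hA
  have h1 := cayley_identity hB Q
  rw [hQ, neg_smul_neg] at h1
  have step : ∀ x : Fin n → ℝ, x ⬝ᵥ (Q *ᵥ x) - (B *ᵥ x) ⬝ᵥ (Q *ᵥ (B *ᵥ x))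
      = 2 * ((G *ᵥ x) ⬝ᵥ (P *ᵥ (G *ᵥ x))) := by
    intro x
    have hxG : (1 - A) *ᵥ (G *ᵥ x) = x := by
      rw [Matrix.mulVec_mulVec, hG1, Matrix.one_mulVec]
    have h := quad_transpose (1 - A) (Q - Bᵀ * Q * B) (G *ᵥ x)
    rw [hxG, h1, Matrix.sub_mulVec, dotProduct_sub, quad_transpose, Matrix.smul_mulVec,
      dotProduct_smul, smul_eq_mul] at h
    exact h.symm
  have stepnn : ∀ x : Fin n → ℝ, (B *ᵥ x) ⬝ᵥ (Q *ᵥ (B *ᵥ x)) ≤ x ⬝ᵥ (Q *ᵥ x) := by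
    intro x
    have := hP.posSemidef.dotProduct_mulVec_nonneg (G *ᵥ x)
    rw [star_trivial] at this
    linarith [step x]
  let f : ℕ → ℝ := fun k => (B ^ k *ᵥ x) ⬝ᵥ (Q *ᵥ (B ^ k *ᵥ x))
  have hf : Antitone f := antitone_nat_of_succ_le fun k => by
    have := stepnn (B ^ k *ᵥ x)
    rw [Matrix.mulVec_mulVec x B, ← pow_succ'] at this
    exact this
  have hcont : Continuous fun M : Matrix (Fin n) (Fin n) ℝ => (M *ᵥ x) ⬝ᵥ (Q *ᵥ (M *ᵥ x)) := by
    fun_prop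
  have h4 := (hcont.tendsto 0).comp hlim
  simp only [Matrix.zero_mulVec, zero_dotProduct] at h4
  have h5 : 0 ≤ f 1 := hf.le_of_tendsto h4 1
  simp only [f, pow_one] at h5
  have hGx : G *ᵥ x ≠ 0 := by
    intro h
    apply hx
    have : (1 - A) *ᵥ (G *ᵥ x) = x := by
      rw [Matrix.mulVec_mulVec, hG1, Matrix.one_mulVec]
    rw [← this, h, Matrix.mulVec_zero]
  have := hP.dotProduct_mulVec_pos hGx
  rw [star_trivial] at this
  linarith [step x]

lemma lyap_surj {n : ℕ} {A : Matrix (Fin n) (Fin n) ℝ} (hA : IsHurwitz A)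
    (C : Matrix (Fin n) (Fin n) ℝ) : ∃ X, Aᵀ * X + X * A = C := by
  let L : Matrix (Fin n) (Fin n) ℝ →ₗ[ℝ] Matrix (Fin n) (Fin n) ℝ :=
    LinearMap.mulLeft ℝ Aᵀ + LinearMap.mulRight ℝ A
  have hL : Function.Injective L := by
    rw [injective_iff_map_eq_zero]
    intro X hX
    exact lyap_inj hA X (by simpa [L] using hX)
  obtain ⟨X, hX⟩ := (LinearMap.injective_iff_surjective.1 hL) C
  exact ⟨X, by simpa [L] using hX⟩

lemma lyap_conv {n : ℕ} {A Q : Matrix (Fin n) (Fin n) ℝ} (hQ : Q.PosDef)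
    (h : Aᵀ * Q + Q * A = -1) : IsHurwitz A := by
  intro μ hμ
  obtain ⟨v, hv, hvμ⟩ := (mem_spectrum_iff_eigvec _ _).1 hμ
  obtain ⟨x, hx⟩ : ∃ x : Fin n → ℝ, x = fun i => (v i).re := ⟨_, rfl⟩
  obtain ⟨y, hy⟩ : ∃ y : Fin n → ℝ, y = fun i => (v i).im := ⟨_, rfl⟩
  have hAx : A *ᵥ x = μ.re • x - μ.im • y := by
    funext i
    have := congrArg Complex.re (congrFun hvμ i)
    simpa [Matrix.mulVec, dotProduct, hx, hy] using this
  have hAy : A *ᵥ y = μ.re • y + μ.im • x := by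
    funext i
    have := congrArg Complex.im (congrFun hvμ i)
    simpa [Matrix.mulVec, dotProduct, hx, hy] using this
  have hsymm : ∀ a b : Fin n → ℝ, a ⬝ᵥ (Q *ᵥ b) = b ⬝ᵥ (Q *ᵥ a) := by
    intro a b
    have hQt : Qᵀ = Q := by simpa using hQ.isHermitian.eq
    rw [Matrix.dotProduct_mulVec, ← Matrix.mulVec_transpose, hQt, dotProduct_comm]
  have key : ∀ a : Fin n → ℝ, 2 * ((A *ᵥ a) ⬝ᵥ (Q *ᵥ a)) = -(a ⬝ᵥ a) := by
    intro a
    have h1 := congrArg (fun M => a ⬝ᵥ (M *ᵥ a)) h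
    simp only [Matrix.add_mulVec, dotProduct_add, Matrix.neg_mulVec, Matrix.one_mulVec,
      dotProduct_neg, ← Matrix.mulVec_mulVec] at h1
    rw [hsymm a (A *ᵥ a), Matrix.dotProduct_mulVec a Aᵀ, Matrix.vecMul_transpose] at h1
    linarith
  have kx := key x
  have ky := key y
  rw [hAx, sub_dotProduct, smul_dotProduct, smul_dotProduct, smul_eq_mul, smul_eq_mul] at kx
  rw [hAy, add_dotProduct, smul_dotProduct, smul_dotProduct, smul_eq_mul, smul_eq_mul,
    hsymm x y] at ky
  have nn : ∀ a : Fin n → ℝ, 0 ≤ a ⬝ᵥ (Q *ᵥ a) := fun a => by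
    simpa using hQ.posSemidef.dotProduct_mulVec_nonneg a
  have sx : 0 ≤ x ⬝ᵥ x := Finset.sum_nonneg fun i _ => mul_self_nonneg _
  have sy : 0 ≤ y ⬝ᵥ y := Finset.sum_nonneg fun i _ => mul_self_nonneg _
  have hpos : 0 < x ⬝ᵥ x + y ⬝ᵥ y := by
    rcases (add_nonneg sx sy).lt_or_eq with h' | h'
    · exact h'
    · exfalso
      have hx0 : x = 0 := dotProduct_self_eq_zero.1 (by linarith)
      have hy0 : y = 0 := dotProduct_self_eq_zero.1 (by linarith)
      apply hv
      funext i
      apply Complex.ext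
      · simpa [hx] using congrFun hx0 i
      · simpa [hy] using congrFun hy0 i
  by_contra hμ'
  push Not at hμ'
  have := mul_nonneg hμ' (add_nonneg (nn x) (nn y))
  nlinarith

/-- **Lyapunov Lemma.** A real `n×n` matrix `A` is Hurwitz if and only if for every
symmetric positive definite `P` there is a (unique) symmetric positive definite `Q`
with `AᵀQ + QA = −P`. -/
theorem lyapunov_lemma {n : ℕ} (A : Matrix (Fin n) (Fin n) ℝ) :
    IsHurwitz A ↔
      ∀ P : Matrix (Fin n) (Fin n) ℝ, P.PosDef →
        ∃! Q : Matrix (Fin n) (Fin n) ℝ, Q.PosDef ∧ Aᵀ * Q + Q * A = -P := by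
  constructor
  · intro hA P hP
    have uniq : ∀ X Y : Matrix (Fin n) (Fin n) ℝ, Aᵀ * X + X * A = -P →
        Aᵀ * Y + Y * A = -P → X = Y := by
      intro X Y hX hY
      rw [← sub_eq_zero]
      apply lyap_inj hA
      rw [Matrix.mul_sub, Matrix.sub_mul, sub_add_sub_comm, hX, hY, sub_self]
    obtain ⟨Q, hQ⟩ := lyap_surj hA (-P)
    refine ⟨Q, ⟨?_, hQ⟩, fun Y hY => uniq Y Q hY.2 hQ⟩
    have hPt : Pᵀ = P := by simpa using hP.isHermitian.eq
    have hQt : Qᵀ = Q := by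
      apply uniq _ _ _ hQ
      have := congrArg Matrix.transpose hQ
      rw [Matrix.transpose_add, Matrix.transpose_mul, Matrix.transpose_mul,
        Matrix.transpose_transpose, Matrix.transpose_neg, hPt, add_comm] at this
      exact this
    refine Matrix.PosDef.of_dotProduct_mulVec_pos ?_ fun x hx => ?_
    · rw [Matrix.IsHermitian, Matrix.conjTranspose_eq_transpose_of_trivial, hQt]
    · rw [star_trivial]
      exact lyap_pos hA hP hQ x hx
  · intro h
    obtain ⟨Q, ⟨hQ, hQ'⟩, -⟩ := h 1 Matrix.PosDef.one
    exact lyap_conv hQ hQ'
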